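/- arXiv:1103.5830 — 2 statements merged into one kernel-verified Lean document; each statement's English description precedes it below -/
import Mathlib

section
/- Let K be a field and let L be a field extension of K of degree 2. Then the action of GL₂(K) on ℙ¹(L) (through the inclusion GL₂(K) → GL₂(L)) is transitive on the complement of the image of ι : ℙ¹(K) → ℙ¹(L); that is, for any two points Q, Q′ of ℙ¹(L) that are not in the image of ι, there exists g ∈ GL₂(K) with g·Q = Q′. -/
open scoped LinearAlgebra.Projectivization

/-- The action of `GL₂(F)` on the projective line `ℙ¹(F) = ℙ F (Fin 2 → F)`, induced by the
linear action of an invertible matrix on `F²`. -/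
noncomputable def pact {F : Type*} [Field F] (g : GL (Fin 2) F) :
    ℙ F (Fin 2 → F) → ℙ F (Fin 2 → F) :=
  Projectivization.map
    ((Matrix.GeneralLinearGroup.toLin g : LinearMap.GeneralLinearGroup F (Fin 2 → F)) :
      (Fin 2 → F) →ₗ[F] (Fin 2 → F))
    (LinearMap.GeneralLinearGroup.toLinearEquiv (Matrix.GeneralLinearGroup.toLin g)).injective

/-- The semilinear map `K² → L²` induced by the inclusion of a field `K` into an extension
field `L`. -/
def baseChangeSL (K L : Type*) [Field K] [Field L] [Algebra K L] :
    (Fin 2 → K) →ₛₗ[algebraMap K L] (Fin 2 → L) where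
  toFun v := fun i => algebraMap K L (v i)
  map_add' u v := by funext i; simp
  map_smul' a v := by funext i; simp [Algebra.smul_def]

/-- The injection `ι : ℙ¹(K) → ℙ¹(L)` induced by the inclusion `K² ⊆ L²`. -/
noncomputable def iotaP (K L : Type*) [Field K] [Field L] [Algebra K L] :
    ℙ K (Fin 2 → K) → ℙ L (Fin 2 → L) :=
  Projectivization.map (baseChangeSL K L)
    (fun _ _ huv => funext fun i => (algebraMap K L).injective (congrFun huv i))

theorem linearIndependent_of_mk_notMem_range_iotaP {K L : Type*} [Field K] [Field L] [Algebra K L]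
    {v : Fin 2 → L} (hv : v ≠ 0)
    (h : Projectivization.mk L v hv ∉ Set.range (iotaP K L)) : LinearIndependent K v := by
  rw [Fintype.linearIndependent_iff]
  intro c hc
  rw [Fin.sum_univ_two, Algebra.smul_def, Algebra.smul_def] at hc
  by_contra! hne
  have hu : ![c 1, -c 0] ≠ 0 := by
    rintro hu
    have h1 : c 1 = 0 := congrFun hu 0
    have h0 : c 0 = 0 := neg_eq_zero.mp (congrFun hu 1)
    obtain ⟨i, hi⟩ := hne
    fin_cases i <;> contradiction
  refine h ⟨Projectivization.mk K ![c 1, -c 0] hu, ?_⟩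
  refine ((Projectivization.mk_eq_mk_iff' L _ _ hv _).mpr ?_).symm
  by_cases h1 : c 1 = 0
  · have h0 : c 0 ≠ 0 := fun h0 => hu (by simp [h0, h1])
    have h0' : algebraMap K L (c 0) ≠ 0 := by simpa using h0
    refine ⟨-v 1 / algebraMap K L (c 0), ?_⟩
    have hv0 : v 0 = 0 := by simpa [h1, h0] using hc
    ext i
    fin_cases i
    · simp [baseChangeSL, h1, hv0]
    · simp [baseChangeSL, h0]
  · have h1' : algebraMap K L (c 1) ≠ 0 := by simpa using h1
    refine ⟨v 0 / algebraMap K L (c 1), ?_⟩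
    ext i
    fin_cases i
    · simp [baseChangeSL, h1]
    · simp only [baseChangeSL, LinearMap.coe_mk, AddHom.coe_mk, Pi.smul_apply, smul_eq_mul,
        Fin.mk_one, Matrix.cons_val_one, Matrix.cons_val_fin_one, map_neg]
      field_simp
      linear_combination -hc

theorem exists_gl_map_mulVec_eq {K L : Type*} [Field K] [Field L] [Algebra K L] {n : Type*}
    [Fintype n] [DecidableEq n] (b c : Module.Basis n K L) :
    ∃ g : GL n K, (g.1.map (algebraMap K L)).mulVec b = c := by
  refine ⟨⟨(b.toMatrix c).transpose, (c.toMatrix b).transpose, ?_, ?_⟩, ?_⟩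
  · rw [← Matrix.transpose_mul, c.toMatrix_mul_toMatrix_flip, Matrix.transpose_one]
  · rw [← Matrix.transpose_mul, b.toMatrix_mul_toMatrix_flip, Matrix.transpose_one]
  · ext i
    simpa [Matrix.mulVec, dotProduct, Module.Basis.toMatrix_apply, Algebra.smul_def] using
      b.sum_repr (c i)

/-- If `L/K` is a quadratic field extension, then `GL₂(K)`, acting on `ℙ¹(L)` through the
inclusion `GL₂(K) → GL₂(L)`, acts transitively on the complement of the image of
`ι : ℙ¹(K) → ℙ¹(L)`. -/
theorem gl2K_transitive_off_P1K (K L : Type*) [Field K] [Field L] [Algebra K L]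
    (hdim : Module.finrank K L = 2)
    (Q Q' : ℙ L (Fin 2 → L))
    (hQ : Q ∉ Set.range (iotaP K L)) (hQ' : Q' ∉ Set.range (iotaP K L)) :
    ∃ g : GL (Fin 2) K, pact (Matrix.GeneralLinearGroup.map (algebraMap K L) g) Q = Q' := by
  induction Q using Projectivization.ind with | h v hv => ?_
  induction Q' using Projectivization.ind with | h w hw => ?_
  have hcard : Fintype.card (Fin 2) = Module.finrank K L := by simp [hdim]
  obtain ⟨g, hg⟩ := exists_gl_map_mulVec_eq
    (basisOfLinearIndependentOfCardEqFinrank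
      (linearIndependent_of_mk_notMem_range_iotaP hv hQ) hcard)
    (basisOfLinearIndependentOfCardEqFinrank
      (linearIndependent_of_mk_notMem_range_iotaP hw hQ') hcard)
  simp only [coe_basisOfLinearIndependentOfCardEqFinrank] at hg
  refine ⟨g, ?_⟩
  exact (Projectivization.mk_eq_mk_iff' L _ _ _ hw).mpr ⟨1, by rw [one_smul, ← hg]; rfl⟩
end

section
/- Let K be a finite field with q elements, L a field extension of K of degree 2, and B ≤ GL₂(K) the subgroup of invertible upper-triangular matrices. Under the diagonal action of B on ℙ¹(K) × ℙ¹(L): (a) {([1:0], ι([1:0]))} is an orbit of cardinality 1; (b) {(P, ι(P)) : P ≠ [1:0]} is an orbit of cardinality q; (c) {([1:0], ι(P′)) : P′ ≠ [1:0]} and {(P, ι([1:0])) : P ≠ [1:0]} are orbits of cardinality q; (d) {(P, ι(P′)) : P ≠ [1:0], P′ ≠ [1:0], P ≠ P′} is an orbit of cardinality q(q−1); and (e) the set {(P, Q) : Q not in the image of ι} is a disjoint union of exactly q+1 orbits, each of cardinality q(q−1). In particular the total number of B-orbits on ℙ¹(K) × ℙ¹(L) is q+6. -/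
open scoped LinearAlgebra.Projectivization

/-- The diagonal action of `g ∈ GL₂(K)` on `ℙ¹(K) × ℙ¹(L)`, acting on the second factor
through the inclusion `GL₂(K) → GL₂(L)`. -/
noncomputable def diagAct {K L : Type*} [Field K] [Field L] [Algebra K L]
    (g : GL (Fin 2) K) (p : ℙ K (Fin 2 → K) × ℙ L (Fin 2 → L)) :
    ℙ K (Fin 2 → K) × ℙ L (Fin 2 → L) :=
  (pact g p.1, pact (Matrix.GeneralLinearGroup.map (algebraMap K L) g) p.2)

/-- The point `[1 : 0]` of the projective line over a field `F`. -/
noncomputable def ptOneZero (F : Type*) [Field F] : ℙ F (Fin 2 → F) :=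
  Projectivization.mk F ![1, 0] (fun h => by simpa using congrFun h 0)

/-- The orbit of a point of `ℙ¹(K) × ℙ¹(L)` under the diagonal action of the Borel subgroup
`B ≤ GL₂(K)` of invertible upper-triangular matrices. -/
noncomputable def borelOrbit {K L : Type*} [Field K] [Field L] [Algebra K L]
    (p : ℙ K (Fin 2 → K) × ℙ L (Fin 2 → L)) :
    Set (ℙ K (Fin 2 → K) × ℙ L (Fin 2 → L)) :=
  {p' | ∃ g : GL (Fin 2) K, (g : Matrix (Fin 2) (Fin 2) K) 1 0 = 0 ∧ diagAct g p = p'}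

/-- The points of the projective line, with `none` sent to `[1 : 0]` and `some x` to `[x : 1]`. -/
noncomputable def optionPt (F : Type*) [Field F] : Option F → ℙ F (Fin 2 → F)
  | none => ptOneZero F
  | some x => Projectivization.mk F ![x, 1] (fun h => by simpa using congrFun h 1)

theorem optionPt_injective (F : Type*) [Field F] : Function.Injective (optionPt F) := by
  rintro (_ | x) (_ | y) h
  · rfl
  · obtain ⟨a, ha⟩ := (Projectivization.mk_eq_mk_iff' F _ _ _ _).1 h
    have h0 := congrFun ha 0
    have h1 := congrFun ha 1
    simp at h0 h1
    simp [h1] at h0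
  · obtain ⟨a, ha⟩ := (Projectivization.mk_eq_mk_iff' F _ _ _ _).1 h
    have h1 := congrFun ha 1
    simp at h1
  · obtain ⟨a, ha⟩ := (Projectivization.mk_eq_mk_iff' F _ _ _ _).1 h
    have h0 := congrFun ha 0
    have h1 := congrFun ha 1
    simp at h0 h1
    subst h1
    simpa using h0.symm

theorem optionPt_surjective (F : Type*) [Field F] : Function.Surjective (optionPt F) := by
  intro P
  induction P using Projectivization.ind with
  | h v hv =>
    by_cases h1 : v 1 = 0
    · have h0 : v 0 ≠ 0 := by
        intro h0
        apply hv
        funext i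
        fin_cases i <;> simp [h0, h1]
      refine ⟨none, (Projectivization.mk_eq_mk_iff' F _ _ _ _).2 ⟨(v 0)⁻¹, ?_⟩⟩
      funext i
      fin_cases i <;> simp [h0, h1]
    · refine ⟨some (v 0 / v 1), (Projectivization.mk_eq_mk_iff' F _ _ _ _).2 ⟨(v 1)⁻¹, ?_⟩⟩
      funext i
      fin_cases i <;> simp [h1]
      field_simp

theorem pact_mk {F : Type*} [Field F] (g : GL (Fin 2) F) (v : Fin 2 → F) (hv : v ≠ 0)
    (hw : (g : Matrix (Fin 2) (Fin 2) F).mulVec v ≠ 0) :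
    pact g (Projectivization.mk F v hv) =
      Projectivization.mk F ((g : Matrix (Fin 2) (Fin 2) F).mulVec v) hw :=
  rfl

theorem pact_optionPt {F : Type*} [Field F] (g : GL (Fin 2) F)
    (hg : (g : Matrix (Fin 2) (Fin 2) F) 1 0 = 0) (o : Option F) :
    pact g (optionPt F o) = optionPt F (o.map fun x =>
      (g : Matrix (Fin 2) (Fin 2) F) 0 0 / (g : Matrix (Fin 2) (Fin 2) F) 1 1 * x +
        (g : Matrix (Fin 2) (Fin 2) F) 0 1 / (g : Matrix (Fin 2) (Fin 2) F) 1 1) := by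
  have hdet : (g : Matrix (Fin 2) (Fin 2) F).det ≠ 0 := g.det_ne_zero
  rw [Matrix.det_fin_two, hg, mul_zero, sub_zero] at hdet
  have h11 := right_ne_zero_of_mul hdet
  cases o with
  | none =>
    refine (Projectivization.mk_eq_mk_iff' F _ _ _ _).2
      ⟨(g : Matrix (Fin 2) (Fin 2) F) 0 0, ?_⟩
    funext i
    fin_cases i <;> simp [Matrix.mulVec, dotProduct, Fin.sum_univ_two, hg]
  | some x =>
    refine (Projectivization.mk_eq_mk_iff' F _ _ _ _).2
      ⟨(g : Matrix (Fin 2) (Fin 2) F) 1 1, ?_⟩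
    funext i
    fin_cases i <;> simp [Matrix.mulVec, dotProduct, Fin.sum_univ_two, hg]
    field_simp

theorem iotaP_optionPt (K L : Type*) [Field K] [Field L] [Algebra K L] (o : Option K) :
    iotaP K L (optionPt K o) = optionPt L (o.map (algebraMap K L)) := by
  cases o <;>
  · refine (Projectivization.mk_eq_mk_iff' L _ _ _ _).2 ⟨1, ?_⟩
    funext i
    fin_cases i <;> simp [baseChangeSL]

/-- The product of the coordinates `optionPt` on two projective lines. -/
noncomputable def optionPtProd (K L : Type*) [Field K] [Field L] :
    Option K × Option L → ℙ K (Fin 2 → K) × ℙ L (Fin 2 → L) :=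
  Prod.map (optionPt K) (optionPt L)

theorem optionPtProd_injective (K L : Type*) [Field K] [Field L] :
    Function.Injective (optionPtProd K L) :=
  (optionPt_injective K).prodMap (optionPt_injective L)

theorem optionPtProd_surjective (K L : Type*) [Field K] [Field L] :
    Function.Surjective (optionPtProd K L) :=
  (optionPt_surjective K).prodMap (optionPt_surjective L)

section

variable {K L : Type*} [Field K] [Field L] [Algebra K L]

/-- The diagonal action of the affine map `x ↦ u * x + b` in the coordinates `optionPt`. -/
def affineAct (u : Kˣ) (b : K) (p : Option K × Option L) : Option K × Option L :=
  (p.1.map fun x => u * x + b, p.2.map fun y => algebraMap K L u * y + algebraMap K L b)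

theorem mem_borelOrbit_optionPtProd (x : Option K × Option L)
    (p : ℙ K (Fin 2 → K) × ℙ L (Fin 2 → L)) :
    p ∈ borelOrbit (optionPtProd K L x) ↔ ∃ u b, optionPtProd K L (affineAct u b x) = p := by
  constructor
  · rintro ⟨g, hg, rfl⟩
    have hdet : (g : Matrix (Fin 2) (Fin 2) K).det ≠ 0 := g.det_ne_zero
    rw [Matrix.det_fin_two, hg, mul_zero, sub_zero] at hdet
    refine ⟨Units.mk0 _ (div_ne_zero (left_ne_zero_of_mul hdet) (right_ne_zero_of_mul hdet)),
      (g : Matrix (Fin 2) (Fin 2) K) 0 1 / (g : Matrix (Fin 2) (Fin 2) K) 1 1, ?_⟩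
    refine Prod.ext ?_ ?_
    · exact (pact_optionPt g hg x.1).symm
    · refine Eq.trans ?_ (pact_optionPt (Matrix.GeneralLinearGroup.map (algebraMap K L) g)
        (by simp [hg]) x.2).symm
      simp [optionPtProd, affineAct]
  · rintro ⟨u, b, rfl⟩
    have hdet : (!![(u : K), b; 0, 1]).det ≠ 0 := by simp [Matrix.det_fin_two]
    refine ⟨Matrix.GeneralLinearGroup.mkOfDetNeZero !![(u : K), b; 0, 1] hdet, ?_, ?_⟩
    · simp [Matrix.GeneralLinearGroup.mkOfDetNeZero]
    refine Prod.ext ?_ ?_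
    · refine (pact_optionPt _ ?_ x.1).trans ?_ <;>
        simp [optionPtProd, affineAct, Matrix.GeneralLinearGroup.mkOfDetNeZero]
    · refine (pact_optionPt _ ?_ x.2).trans ?_ <;>
        simp [optionPtProd, affineAct, Matrix.GeneralLinearGroup.mkOfDetNeZero]

theorem affineAct_affineAct (u v : Kˣ) (b c : K) (x : Option K × Option L) :
    affineAct v c (affineAct u b x) = affineAct (v * u) (v * b + c) x := by
  rcases x with ⟨_ | x, _ | y⟩ <;> simp [affineAct] <;> (try constructor) <;> ring

theorem affineAct_inv (u : Kˣ) (b : K) (x : Option K × Option L) :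
    affineAct u⁻¹ (-(↑u⁻¹ * b)) (affineAct u b x) = x := by
  rw [affineAct_affineAct]
  rcases x with ⟨_ | x, _ | y⟩ <;> simp [affineAct]

theorem borelOrbit_affineAct (u : Kˣ) (b : K) (x : Option K × Option L) :
    borelOrbit (optionPtProd K L (affineAct u b x)) = borelOrbit (optionPtProd K L x) := by
  ext p
  simp only [mem_borelOrbit_optionPtProd]
  constructor
  · rintro ⟨v, c, rfl⟩
    exact ⟨v * u, v * b + c, by rw [affineAct_affineAct]⟩
  · rintro ⟨v, c, rfl⟩
    refine ⟨v * u⁻¹, v * (-(↑u⁻¹ * b)) + c, ?_⟩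
    rw [← affineAct_affineAct, affineAct_inv]

/-- Two affine maps over `K` that agree at a point of `L` outside `K` are equal. -/
theorem affine_eq_of_notMem_range {θ : L} (hθ : θ ∉ Set.range (algebraMap K L)) {a a' b b' : K}
    (h : algebraMap K L a * θ + algebraMap K L b = algebraMap K L a' * θ + algebraMap K L b') :
    a = a' ∧ b = b' := by
  have ha : a = a' := by
    by_contra hne
    have hne' : algebraMap K L a - algebraMap K L a' ≠ 0 := by
      rw [sub_ne_zero]
      exact fun e => hne ((algebraMap K L).injective e)
    refine hθ ⟨(b' - b) / (a - a'), ?_⟩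
    rw [map_div₀, map_sub, map_sub, div_eq_iff hne']
    linear_combination -h
  subst ha
  exact ⟨rfl, (algebraMap K L).injective (add_left_cancel h)⟩

theorem exists_notMem_range_algebraMap (hdim : Module.finrank K L = 2) :
    ∃ θ : L, θ ∉ Set.range (algebraMap K L) := by
  by_contra! h
  have := finrank_eq_one (R := K) (1 : L) one_ne_zero fun y => by
    obtain ⟨a, rfl⟩ := h y
    exact ⟨a, by simp [Algebra.smul_def]⟩
  omega

theorem exists_eq_affine (hdim : Module.finrank K L = 2) {θ : L}
    (hθ : θ ∉ Set.range (algebraMap K L)) (y : L) :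
    ∃ a b : K, algebraMap K L a * θ + algebraMap K L b = y := by
  have hli : LinearIndependent K ![θ, 1] := by
    rw [LinearIndependent.pair_iff]
    intro s t hst
    apply affine_eq_of_notMem_range hθ
    simpa [Algebra.smul_def] using hst
  have hspan := hli.span_eq_top_of_card_eq_finrank (by simp [hdim])
  have hy : y ∈ Submodule.span K (Set.range ![θ, 1]) := hspan ▸ Submodule.mem_top
  rw [Matrix.range_cons, Matrix.range_cons, Matrix.range_empty, Set.union_empty,
    Set.singleton_union, Submodule.mem_span_pair] at hy
  obtain ⟨a, b, h⟩ := hy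
  exact ⟨a, b, by simpa [Algebra.smul_def] using h⟩

theorem exists_eq_affine_unit (hdim : Module.finrank K L = 2) {θ : L}
    (hθ : θ ∉ Set.range (algebraMap K L)) {y : L} (hy : y ∉ Set.range (algebraMap K L)) :
    ∃ (u : Kˣ) (b : K), algebraMap K L u * θ + algebraMap K L b = y := by
  obtain ⟨a, b, rfl⟩ := exists_eq_affine hdim hθ y
  have ha : a ≠ 0 := by
    rintro rfl
    exact hy ⟨b, by simp⟩
  exact ⟨Units.mk0 a ha, b, rfl⟩

theorem affine_notMem_range {θ : L} (hθ : θ ∉ Set.range (algebraMap K L)) (u : Kˣ) (b : K) :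
    algebraMap K L u * θ + algebraMap K L b ∉ Set.range (algebraMap K L) := by
  rintro ⟨c, hc⟩
  have h := affine_eq_of_notMem_range hθ (a := u) (b := b) (a' := 0) (b' := c) (by simp [hc])
  exact u.ne_zero h.1

/-- An orbit with trivial stabilizers in the group of affine maps has `q * (q - 1)` elements. -/
theorem card_borelOrbit_of_injective [Fintype K] (x : Option K × Option L)
    (hx : Function.Injective fun ub : Kˣ × K => affineAct ub.1 ub.2 x) :
    Nat.card (borelOrbit (optionPtProd K L x)) = Fintype.card K * (Fintype.card K - 1) := by
  classical
  have h : borelOrbit (optionPtProd K L x) =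
      Set.range (optionPtProd K L ∘ fun ub : Kˣ × K => affineAct ub.1 ub.2 x) := by
    ext p
    simp [mem_borelOrbit_optionPtProd]
  rw [h, Nat.card_range_of_injective ((optionPtProd_injective K L).comp hx), Nat.card_prod,
    Nat.card_eq_fintype_card, Nat.card_eq_fintype_card, Fintype.card_units, mul_comm]

/-- Representatives of the Borel orbits, for `θ` in `L` outside `K`. -/
def borelRep (K : Type*) {L : Type*} [Field K] [Field L] (θ : L) :
    Fin 5 ⊕ Option K → Option K × Option L :=
  Sum.elim ![(none, none), (some 0, some 0), (none, some 0), (some 0, none), (some 1, some 0)]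
    fun o => (o, some θ)

theorem eq_of_affineAct_borelRep_eq {θ : L} (hθ : θ ∉ Set.range (algebraMap K L)) (u : Kˣ) (b : K)
    (i j : Fin 5 ⊕ Option K)
    (h : affineAct u b (borelRep K θ i) = borelRep K θ j) : i = j := by
  have hθu := affine_notMem_range hθ u b
  rcases i with i | o <;> rcases j with j | o'
  · fin_cases i <;> fin_cases j <;> simp [affineAct, borelRep] at h ⊢
    · simp [h.1] at h
    · obtain ⟨h1, rfl⟩ := h
      simp at h1
  · exfalso
    fin_cases i <;> simp [affineAct, borelRep] at h
    all_goals exact hθ ⟨b, h.2⟩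
  · exfalso
    fin_cases j <;> simp [affineAct, borelRep] at h
    all_goals exact hθu ⟨0, by simp [h.2]⟩
  · simp only [affineAct, borelRep, Sum.elim_inr, Prod.mk.injEq, Option.map_some,
      Option.some.injEq] at h
    obtain ⟨h1, h2⟩ := h
    obtain ⟨hu, rfl⟩ := affine_eq_of_notMem_range hθ (a' := 1) (b' := 0) (by simpa using h2)
    rw [← h1]
    simp [hu]

theorem exists_affineAct_borelRep (hdim : Module.finrank K L = 2) {θ : L}
    (hθ : θ ∉ Set.range (algebraMap K L)) (x : Option K × Option L) :
    ∃ i u b, affineAct u b (borelRep K θ i) = x := by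
  obtain ⟨o, _ | y⟩ := x
  · obtain _ | x := o
    · exact ⟨Sum.inl 0, 1, 0, by simp [affineAct, borelRep]⟩
    · exact ⟨Sum.inl 3, 1, x, by simp [affineAct, borelRep]⟩
  by_cases hy : y ∈ Set.range (algebraMap K L)
  · obtain ⟨y, rfl⟩ := hy
    obtain _ | x := o
    · exact ⟨Sum.inl 2, 1, y, by simp [affineAct, borelRep]⟩
    · by_cases hxy : x = y
      · exact ⟨Sum.inl 1, 1, y, by simp [affineAct, borelRep, hxy]⟩
      · exact ⟨Sum.inl 4, Units.mk0 (x - y) (sub_ne_zero.2 hxy), y,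
          by simp [affineAct, borelRep]⟩
  · obtain ⟨u, b, rfl⟩ := exists_eq_affine_unit hdim hθ hy
    refine ⟨Sum.inr (o.map fun x => ↑u⁻¹ * (x - b)), u, b, ?_⟩
    cases o <;> simp [affineAct, borelRep]

theorem card_borelOrbits [Fintype K] (hdim : Module.finrank K L = 2) :
    Nat.card {S : Set (ℙ K (Fin 2 → K) × ℙ L (Fin 2 → L)) // ∃ p, S = borelOrbit p} =
      Fintype.card K + 6 := by
  obtain ⟨θ, hθ⟩ := exists_notMem_range_algebraMap hdim
  have hbij : Function.Bijective (fun i : Fin 5 ⊕ Option K =>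
      (⟨borelOrbit (optionPtProd K L (borelRep K θ i)), _, rfl⟩ :
        {S : Set (ℙ K (Fin 2 → K) × ℙ L (Fin 2 → L)) // ∃ p, S = borelOrbit p})) := by
    constructor
    · intro i j h
      have h' : borelOrbit (optionPtProd K L (borelRep K θ i)) =
        borelOrbit (optionPtProd K L (borelRep K θ j)) := congrArg Subtype.val h
      have hm : optionPtProd K L (affineAct 1 0 (borelRep K θ j)) ∈
          borelOrbit (optionPtProd K L (borelRep K θ i)) := by
        rw [h', mem_borelOrbit_optionPtProd]
        exact ⟨1, 0, rfl⟩
      obtain ⟨u, b, hub⟩ := (mem_borelOrbit_optionPtProd _ _).1 hm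
      refine eq_of_affineAct_borelRep_eq hθ u b i j ((optionPtProd_injective K L hub).trans ?_)
      simp [affineAct]
    · rintro ⟨_, p, rfl⟩
      obtain ⟨x, rfl⟩ := optionPtProd_surjective K L p
      obtain ⟨i, u, b, rfl⟩ := exists_affineAct_borelRep hdim hθ x
      exact ⟨i, Subtype.ext (borelOrbit_affineAct u b _).symm⟩
  rw [← Nat.card_eq_of_bijective _ hbij]
  simp
  omega

theorem mem_range_iotaP (y : L) :
    optionPt L (some y) ∈ Set.range (iotaP K L) ↔ y ∈ Set.range (algebraMap K L) := by
  constructor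
  · rintro ⟨P, hP⟩
    obtain ⟨o, rfl⟩ := optionPt_surjective K P
    rw [iotaP_optionPt] at hP
    have h := optionPt_injective L hP
    cases o with
    | none => simp at h
    | some x => exact ⟨x, by simpa using h⟩
  · rintro ⟨x, rfl⟩
    exact ⟨optionPt K (some x), iotaP_optionPt K L _⟩

theorem ne_ptOneZero_iff (P : ℙ K (Fin 2 → K)) :
    P ≠ ptOneZero K ↔ ∃ x, P = optionPt K (some x) := by
  obtain ⟨o, rfl⟩ := optionPt_surjective K P
  rw [show ptOneZero K = optionPt K none from rfl, (optionPt_injective K).ne_iff]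
  cases o <;> simp [(optionPt_injective K).eq_iff]

end

/-- The Borel orbit decomposition of `ℙ¹(K) × ℙ¹(L)` from Section 5.2 of the paper: for `K`
a finite field with `q` elements and `L/K` quadratic, the subgroup `B ≤ GL₂(K)` of
upper-triangular matrices has the `q + 6` orbits described in parts (a)–(e). -/
theorem borel_orbits_on_P1K_P1L (K L : Type*) [Field K] [Field L] [Algebra K L]
    [Fintype K] (q : ℕ) (hq : Fintype.card K = q) (hdim : Module.finrank K L = 2) :
    let e₁ : ℙ K (Fin 2 → K) := ptOneZero K
    let Sa : Set (ℙ K (Fin 2 → K) × ℙ L (Fin 2 → L)) := {(e₁, iotaP K L e₁)}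
    let Sb : Set (ℙ K (Fin 2 → K) × ℙ L (Fin 2 → L)) :=
      {p | ∃ P, P ≠ e₁ ∧ p = (P, iotaP K L P)}
    let Sc : Set (ℙ K (Fin 2 → K) × ℙ L (Fin 2 → L)) :=
      {p | ∃ P', P' ≠ e₁ ∧ p = (e₁, iotaP K L P')}
    let Sc' : Set (ℙ K (Fin 2 → K) × ℙ L (Fin 2 → L)) :=
      {p | ∃ P, P ≠ e₁ ∧ p = (P, iotaP K L e₁)}
    let Sd : Set (ℙ K (Fin 2 → K) × ℙ L (Fin 2 → L)) :=
      {p | ∃ P P', P ≠ e₁ ∧ P' ≠ e₁ ∧ P ≠ P' ∧ p = (P, iotaP K L P')}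
    let Se : Set (ℙ K (Fin 2 → K) × ℙ L (Fin 2 → L)) :=
      {p | p.2 ∉ Set.range (iotaP K L)}
    -- (a)
    (borelOrbit (e₁, iotaP K L e₁) = Sa ∧ Nat.card Sa = 1) ∧
    -- (b)
    ((∃ p, borelOrbit p = Sb) ∧ Nat.card Sb = q) ∧
    -- (c)
    ((∃ p, borelOrbit p = Sc) ∧ Nat.card Sc = q ∧
     (∃ p, borelOrbit p = Sc') ∧ Nat.card Sc' = q) ∧
    -- (d)
    ((∃ p, borelOrbit p = Sd) ∧ Nat.card Sd = q * (q - 1)) ∧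
    -- (e)
    (∃ P : Fin (q + 1) → ℙ K (Fin 2 → K) × ℙ L (Fin 2 → L),
      (∀ i, P i ∈ Se) ∧ (⋃ i, borelOrbit (P i)) = Se ∧
      (∀ i j, i ≠ j → Disjoint (borelOrbit (P i)) (borelOrbit (P j))) ∧
      ∀ i, Nat.card (borelOrbit (P i)) = q * (q - 1)) ∧
    -- total number of Borel orbits
    Nat.card {S : Set (ℙ K (Fin 2 → K) × ℙ L (Fin 2 → L)) // ∃ p, S = borelOrbit p} =
      q + 6 := by
  intro e₁ Sa Sb Sc Sc' Sd Se
  subst hq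
  have he : e₁ = optionPt K none := rfl
  obtain ⟨θ, hθ⟩ := exists_notMem_range_algebraMap hdim
  have hb : Sb = Set.range fun x : K =>
      optionPtProd K L (some x, some (algebraMap K L x)) := by
    ext p
    constructor
    · rintro ⟨P, hP, rfl⟩
      obtain ⟨x, rfl⟩ := (ne_ptOneZero_iff P).1 hP
      exact ⟨x, by rw [iotaP_optionPt]; rfl⟩
    · rintro ⟨x, rfl⟩
      exact ⟨_, (ne_ptOneZero_iff _).2 ⟨x, rfl⟩, by rw [iotaP_optionPt]; rfl⟩
  have hc : Sc = Set.range fun x : K =>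
      optionPtProd K L (none, some (algebraMap K L x)) := by
    ext p
    constructor
    · rintro ⟨P, hP, rfl⟩
      obtain ⟨x, rfl⟩ := (ne_ptOneZero_iff P).1 hP
      exact ⟨x, by rw [iotaP_optionPt]; rfl⟩
    · rintro ⟨x, rfl⟩
      exact ⟨_, (ne_ptOneZero_iff _).2 ⟨x, rfl⟩, by rw [iotaP_optionPt]; rfl⟩
  have hc' : Sc' = Set.range fun x : K => optionPtProd K L (some x, none) := by
    ext p
    constructor
    · rintro ⟨P, hP, rfl⟩
      obtain ⟨x, rfl⟩ := (ne_ptOneZero_iff P).1 hP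
      exact ⟨x, by rw [he, iotaP_optionPt]; rfl⟩
    · rintro ⟨x, rfl⟩
      exact ⟨_, (ne_ptOneZero_iff _).2 ⟨x, rfl⟩, by rw [he, iotaP_optionPt]; rfl⟩
  have hd : borelOrbit (optionPtProd K L (some 1, some 0)) = Sd := by
    ext p
    rw [mem_borelOrbit_optionPtProd]
    constructor
    · rintro ⟨u, b, rfl⟩
      refine ⟨optionPt K (some (u + b)), optionPt K (some b), (ne_ptOneZero_iff _).2 ⟨_, rfl⟩,
        (ne_ptOneZero_iff _).2 ⟨_, rfl⟩, ?_, ?_⟩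
      · simp [(optionPt_injective K).eq_iff]
      · rw [iotaP_optionPt]
        simp [optionPtProd, affineAct]
    · rintro ⟨P, P', hP, hP', hne, rfl⟩
      obtain ⟨x, rfl⟩ := (ne_ptOneZero_iff P).1 hP
      obtain ⟨y, rfl⟩ := (ne_ptOneZero_iff P').1 hP'
      have hxy : x ≠ y := fun h => hne (by rw [h])
      refine ⟨Units.mk0 (x - y) (sub_ne_zero.2 hxy), y, ?_⟩
      rw [iotaP_optionPt]
      simp [optionPtProd, affineAct]
  have horb : ∀ o : Option K, ∀ p, p ∈ borelOrbit (optionPtProd K L (o, some θ)) →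
      p ∈ Se := by
    rintro o p hp
    obtain ⟨u, b, rfl⟩ := (mem_borelOrbit_optionPtProd _ _).1 hp
    exact fun h => affine_notMem_range hθ u b ((mem_range_iotaP _).1 h)
  refine ⟨⟨?_, by simp [Sa]⟩, ⟨⟨optionPtProd K L (some 0, some 0), ?_⟩, ?_⟩,
    ⟨⟨optionPtProd K L (none, some 0), ?_⟩, ?_, ⟨optionPtProd K L (some 0, none), ?_⟩, ?_⟩,
    ⟨⟨_, hd⟩, ?_⟩, ?_, card_borelOrbits hdim⟩
  · have h : (e₁, iotaP K L e₁) = optionPtProd K L (none, none) := by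
      rw [he, iotaP_optionPt]
      rfl
    ext p
    simp only [Sa, h, mem_borelOrbit_optionPtProd, Set.mem_singleton_iff]
    exact ⟨fun ⟨_, _, h⟩ => h.symm, fun h => ⟨1, 0, h.symm⟩⟩
  · rw [hb]
    ext p
    rw [mem_borelOrbit_optionPtProd]
    simp [affineAct]
  · rw [hb, Nat.card_range_of_injective, Nat.card_eq_fintype_card]
    intro x y h
    simpa using optionPtProd_injective K L h
  · rw [hc]
    ext p
    rw [mem_borelOrbit_optionPtProd]
    simp [affineAct]
  · rw [hc, Nat.card_range_of_injective, Nat.card_eq_fintype_card]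
    intro x y h
    simpa using optionPtProd_injective K L h
  · rw [hc']
    ext p
    rw [mem_borelOrbit_optionPtProd]
    simp [affineAct]
  · rw [hc', Nat.card_range_of_injective, Nat.card_eq_fintype_card]
    intro x y h
    simpa using optionPtProd_injective K L h
  · rw [← hd]
    apply card_borelOrbit_of_injective
    rintro ⟨u, b⟩ ⟨v, c⟩ h
    simp [affineAct] at h
    obtain ⟨h1, rfl⟩ := h
    exact Prod.ext (Units.ext (by simpa using h1)) rfl
  · have e : Fin (Fintype.card K + 1) ≃ Option K :=
      (Fintype.equivFinOfCardEq (Fintype.card_option)).symm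
    refine ⟨fun i => optionPtProd K L (e i, some θ), fun i h => hθ ((mem_range_iotaP θ).1 h),
      ?_, ?_, fun i => card_borelOrbit_of_injective _ ?_⟩
    · ext p
      rw [Set.mem_iUnion]
      refine ⟨fun ⟨i, hi⟩ => horb _ p hi, fun hp => ?_⟩
      obtain ⟨⟨o, _ | y⟩, rfl⟩ := optionPtProd_surjective K L p
      · exact absurd ⟨optionPt K none, iotaP_optionPt K L none⟩ hp
      obtain ⟨u, b, rfl⟩ := exists_eq_affine_unit hdim hθ
        fun h => hp ((mem_range_iotaP y).2 h)
      refine ⟨e.symm (o.map fun x => ↑u⁻¹ * (x - b)),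
        (mem_borelOrbit_optionPtProd _ _).2 ⟨u, b, ?_⟩⟩
      cases o <;> simp [affineAct]
    · intro i j hij
      rw [Set.disjoint_left]
      intro p hi hj
      obtain ⟨u, b, rfl⟩ := (mem_borelOrbit_optionPtProd _ _).1 hi
      obtain ⟨v, c, h⟩ := (mem_borelOrbit_optionPtProd _ _).1 hj
      have h' := congrArg (affineAct u⁻¹ (-(↑u⁻¹ * b))) (optionPtProd_injective K L h)
      rw [affineAct_affineAct, affineAct_inv] at h'
      have := eq_of_affineAct_borelRep_eq hθ _ _ (Sum.inr (e j)) (Sum.inr (e i)) h'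
      exact hij (e.injective (Sum.inr_injective this)).symm
    · rintro ⟨u, b⟩ ⟨v, c⟩ h
      have h2 := congrArg Prod.snd h
      simp only [affineAct, Option.map_some, Option.some.injEq] at h2
      obtain ⟨h3, rfl⟩ := affine_eq_of_notMem_range hθ h2
      rw [Units.ext h3]
end
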